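/- arXiv:1502.04638 — 5 statements merged into one kernel-verified Lean document; each statement's English description precedes it below -/
import Mathlib

section
/- The set Ω′ := {ω ∈ Ω : 0 < ∫_𝕌 R_V(u, V(ω)) P_U(du) < ∞} belongs to ℱ and ℙ(Ω′) = 1. -/
open MeasureTheory
open scoped NNReal ENNReal

/-- The second marginal of a measure with density `f` with respect to a product measure has
density `y ↦ ∫⁻ x, f (x, y) ∂μ`. -/
theorem map_snd_withDensity_prod {α β : Type*} [MeasurableSpace α] [MeasurableSpace β]
    (μ : Measure α) [SFinite μ] (ν : Measure β) [SFinite ν]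
    {f : α × β → ℝ≥0∞} (hf : Measurable f) :
    ((μ.prod ν).withDensity f).map Prod.snd = ν.withDensity fun y => ∫⁻ x, f (x, y) ∂μ := by
  ext s hs
  have hs' : MeasurableSet (Prod.snd ⁻¹' s : Set (α × β)) := measurable_snd hs
  rw [Measure.map_apply measurable_snd hs, withDensity_apply _ hs', withDensity_apply _ hs,
    ← lintegral_indicator hs', lintegral_prod_symm' _ (hf.indicator hs'),
    ← lintegral_indicator hs]
  refine lintegral_congr fun y => ?_
  by_cases hy : y ∈ s <;> simp [Set.indicator, hy]

/-- A finite measure with a measurable density has almost everywhere positive and finite density. -/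
theorem ae_withDensity_pos_lt_top {β : Type*} [MeasurableSpace β] {ν : Measure β}
    {f : β → ℝ≥0∞} (hf : Measurable f) [IsFiniteMeasure (ν.withDensity f)] :
    ∀ᵐ y ∂ν.withDensity f, 0 < f y ∧ f y < ⊤ := by
  have hfin : ∫⁻ y, f y ∂ν ≠ ⊤ := by
    simpa using measure_ne_top (ν.withDensity f) Set.univ
  rw [ae_withDensity_iff hf]
  filter_upwards [ae_lt_top hf hfin] with y hy hy0
  exact ⟨pos_iff_ne_zero.mpr hy0, hy⟩

/-- with `P_{UV} = R_V · (P_U ⊗ λ_V)`, the set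
`Ω′ = {ω : 0 < ∫ R_V(u, V(ω)) P_U(du) < ∞}` is measurable and has `ℙ`-probability 1. -/
theorem stmt_1 {Ω 𝕌 𝕍 : Type*} [MeasurableSpace Ω] [MeasurableSpace 𝕌] [MeasurableSpace 𝕍]
    (ℙ : Measure Ω) [IsProbabilityMeasure ℙ]
    (U : Ω → 𝕌) (V : Ω → 𝕍) (hU : Measurable U) (hV : Measurable V)
    (lamV : Measure 𝕍) [SigmaFinite lamV]
    (PU : Measure 𝕌) [IsProbabilityMeasure PU] (hPU : PU = ℙ.map U)
    (RV : 𝕌 × 𝕍 → ℝ≥0) (hRV : Measurable RV)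
    (hjoint : ℙ.map (fun ω => (U ω, V ω)) =
      (PU.prod lamV).withDensity fun p => (RV p : ℝ≥0∞)) :
    MeasurableSet {ω | 0 < ∫⁻ u, (RV (u, V ω) : ℝ≥0∞) ∂PU ∧
        ∫⁻ u, (RV (u, V ω) : ℝ≥0∞) ∂PU < ⊤} ∧
      ℙ {ω | 0 < ∫⁻ u, (RV (u, V ω) : ℝ≥0∞) ∂PU ∧
        ∫⁻ u, (RV (u, V ω) : ℝ≥0∞) ∂PU < ⊤} = 1 := by
  set f : 𝕍 → ℝ≥0∞ := fun v => ∫⁻ u, (RV (u, v) : ℝ≥0∞) ∂PU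
  have hR : Measurable fun p => (RV p : ℝ≥0∞) := hRV.coe_nnreal_ennreal
  have hf : Measurable f := hR.lintegral_prod_left'
  have hmap : ℙ.map V = lamV.withDensity f := by
    rw [← map_snd_withDensity_prod PU lamV hR, ← hjoint,
      Measure.map_map measurable_snd (hU.prodMk hV)]
    rfl
  have hmeas : MeasurableSet {ω | 0 < f (V ω) ∧ f (V ω) < ⊤} :=
    (measurableSet_lt measurable_const (hf.comp hV)).inter
      (measurableSet_lt (hf.comp hV) measurable_const)
  have : IsFiniteMeasure (lamV.withDensity f) := hmap ▸ inferInstance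
  have hae : ∀ᵐ v ∂ℙ.map V, 0 < f v ∧ f v < ⊤ := by
    rw [hmap]
    exact ae_withDensity_pos_lt_top hf
  exact ⟨hmeas, (prob_compl_eq_zero_iff hmeas).mp (ae_of_ae_map hV.aemeasurable hae)⟩
end

section
/- Suppose additionally that W : Ω → 𝕎 is a measurable map into a measurable space (𝕎, 𝒲), that λ_W is a σ-finite measure on 𝒲, that V and W are conditionally independent given U (i.e. for all B ∈ 𝒱 and C ∈ 𝒲, ℙ(V ∈ B, W ∈ C | U) = ℙ(V ∈ B | U)·ℙ(W ∈ C | U) almost surely), and that P_{UW} ≪ P_U ⊗ λ_W with measurable density R_W : 𝕌 × 𝕎 → [0, ∞), dP_{UW} = R_W d(P_U ⊗ λ_W). Let Ω″ := {ω ∈ Ω : 0 < ∫_𝕌 R_W(u, W(ω)) P_{U|V}(ω)(du) < ∞}. Then Ω″ ∈ ℱ, ℙ(Ω″) = 1, and the map P_{U|VW} : Ω → 𝒫(𝒰) defined by P_{U|VW}(ω)(A) = 1_{Ω″}(ω) · (∫_A R_W(u, W(ω)) P_{U|V}(ω)(du)) / (∫_𝕌 R_W(u, W(ω)) P_{U|V}(ω)(du))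 + 1_{Ω∖Ω″}(ω) · P_{U|V}(ω)(A) is a regular (V,W)-conditional distribution for U: for every A ∈ 𝒰 the map ω ↦ P_{U|VW}(ω)(A) is σ(V,W)-measurable, and for every A ∈ 𝒰, B ∈ 𝒱, C ∈ 𝒲, ℙ(U ∈ A, V ∈ B, W ∈ C) = ∫_{{V ∈ B, W ∈ C}} P_{U|VW}(ω)(A) ℙ(dω). -/
open MeasureTheory
open scoped NNReal ENNReal

section JointDensity

variable {Ω 𝕌 𝕏 : Type*} [MeasurableSpace Ω] [MeasurableSpace 𝕌] [MeasurableSpace 𝕏]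
  {ℙ : Measure Ω} {U : Ω → 𝕌} {X : Ω → 𝕏} {PU : Measure 𝕌} {lam : Measure 𝕏}
  {R : 𝕌 × 𝕏 → ℝ≥0∞}

/-- The measure of a rectangle as an iterated integral of the joint density. -/
lemma measure_preimage_inter_eq_lintegral_density [SFinite lam]
    (hU : Measurable U) (hX : Measurable X) (hR : Measurable R)
    (hjoint : ℙ.map (fun ω => (U ω, X ω)) = (PU.prod lam).withDensity R)
    [SFinite PU] {A : Set 𝕌} {D : Set 𝕏} (hA : MeasurableSet A) (hD : MeasurableSet D) :
    ℙ (U ⁻¹' A ∩ X ⁻¹' D) = ∫⁻ u in A, ∫⁻ x in D, R (u, x) ∂lam ∂PU := by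
  have h : ℙ (U ⁻¹' A ∩ X ⁻¹' D) = ℙ.map (fun ω => (U ω, X ω)) (A ×ˢ D) := by
    rw [Measure.map_apply (hU.prodMk hX) (hA.prod hD)]
    rfl
  rw [h, hjoint, withDensity_apply _ (hA.prod hD), ← Measure.prod_restrict,
    lintegral_prod _ hR.aemeasurable]

/-- The marginal law of the observation has density `x ↦ ∫ R (u, x) dP_U(u)`. -/
lemma map_eq_withDensity_lintegral [SFinite lam]
    (hU : Measurable U) (hX : Measurable X) (hR : Measurable R)
    (hjoint : ℙ.map (fun ω => (U ω, X ω)) = (PU.prod lam).withDensity R) [SFinite PU] :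
    ℙ.map X = lam.withDensity fun x => ∫⁻ u, R (u, x) ∂PU := by
  ext D hD
  have h := measure_preimage_inter_eq_lintegral_density hU hX hR hjoint .univ hD
  rw [Set.preimage_univ, Set.univ_inter, Measure.restrict_univ] at h
  rw [Measure.map_apply hX hD, withDensity_apply _ hD, h,
    lintegral_lintegral_swap (f := fun u x => R (u, x)) hR.aemeasurable]

lemma lintegral_density_lt_top_ae [SFinite lam] [IsProbabilityMeasure ℙ]
    (hU : Measurable U) (hX : Measurable X) (hR : Measurable R)
    (hjoint : ℙ.map (fun ω => (U ω, X ω)) = (PU.prod lam).withDensity R) [SFinite PU] :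
    ∀ᵐ x ∂lam, ∫⁻ u, R (u, x) ∂PU < ⊤ := by
  refine ae_lt_top hR.lintegral_prod_left' ?_
  have h := congrArg (fun μ : Measure 𝕏 => μ Set.univ)
    (map_eq_withDensity_lintegral hU hX hR hjoint)
  simp only [Measure.map_apply hX .univ, Set.preimage_univ, measure_univ,
    withDensity_apply _ MeasurableSet.univ, Measure.restrict_univ] at h
  exact h ▸ ENNReal.one_ne_top

/-- Almost surely, the normalizing constant in Bayes' formula is positive and finite. -/
lemma ae_lintegral_density_pos_lt_top [SFinite lam] [IsProbabilityMeasure ℙ]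
    (hU : Measurable U) (hX : Measurable X) (hR : Measurable R)
    (hjoint : ℙ.map (fun ω => (U ω, X ω)) = (PU.prod lam).withDensity R) [SFinite PU] :
    ∀ᵐ ω ∂ℙ, 0 < ∫⁻ u, R (u, X ω) ∂PU ∧ ∫⁻ u, R (u, X ω) ∂PU < ⊤ := by
  refine ae_of_ae_map (f := X)
    (p := fun x => 0 < ∫⁻ u, R (u, x) ∂PU ∧ ∫⁻ u, R (u, x) ∂PU < ⊤) hX.aemeasurable ?_
  rw [map_eq_withDensity_lintegral hU hX hR hjoint,
    ae_withDensity_iff hR.lintegral_prod_left']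
  filter_upwards [lintegral_density_lt_top_ae hU hX hR hjoint] with x hx h0
  exact ⟨pos_iff_ne_zero.2 h0, hx⟩

/-- **Bayes' formula** for a joint density. -/
lemma measure_preimage_inter_eq_setLIntegral_bayes [SFinite lam] [IsProbabilityMeasure ℙ]
    (hU : Measurable U) (hX : Measurable X) (hR : Measurable R)
    (hjoint : ℙ.map (fun ω => (U ω, X ω)) = (PU.prod lam).withDensity R)
    [SFinite PU] {A : Set 𝕌} {D : Set 𝕏} (hA : MeasurableSet A) (hD : MeasurableSet D) :
    ℙ (U ⁻¹' A ∩ X ⁻¹' D) =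
      ∫⁻ ω in X ⁻¹' D, (∫⁻ u, R (u, X ω) ∂PU)⁻¹ * ∫⁻ u in A, R (u, X ω) ∂PU ∂ℙ := by
  have hZ : Measurable fun x => ∫⁻ u, R (u, x) ∂PU := hR.lintegral_prod_left'
  have hN : Measurable fun x => ∫⁻ u in A, R (u, x) ∂PU := hR.lintegral_prod_left'
  rw [measure_preimage_inter_eq_lintegral_density hU hX hR hjoint hA hD,
    lintegral_lintegral_swap (f := fun u x => R (u, x)) hR.aemeasurable,
    ← setLIntegral_map (f := fun x => (∫⁻ u, R (u, x) ∂PU)⁻¹ * ∫⁻ u in A, R (u, x) ∂PU)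
      hD (hZ.inv.mul hN) hX,
    map_eq_withDensity_lintegral hU hX hR hjoint,
    setLIntegral_withDensity_eq_setLIntegral_mul _ hZ
      (g := fun x => (∫⁻ u, R (u, x) ∂PU)⁻¹ * ∫⁻ u in A, R (u, x) ∂PU) (hZ.inv.mul hN) hD]
  refine lintegral_congr_ae (ae_restrict_of_ae ?_)
  filter_upwards [lintegral_density_lt_top_ae hU hX hR hjoint] with x hx
  simp only [Pi.mul_apply]
  rcases eq_or_ne (∫⁻ u, R (u, x) ∂PU) 0 with h0 | h0
  · have hle : ∫⁻ u in A, R (u, x) ∂PU ≤ ∫⁻ u, R (u, x) ∂PU := setLIntegral_le_lintegral _ _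
    rw [h0, zero_mul]
    exact le_antisymm (hle.trans_eq h0) bot_le
  · rw [← mul_assoc, ENNReal.mul_inv_cancel h0 hx.ne, one_mul]

/-- The conditional probability of `X ∈ D` given `U`, computed from the joint density. -/
lemma condExp_indicator_ae_eq_lintegral_density [SFinite lam] [IsProbabilityMeasure ℙ]
    (hU : Measurable U) (hX : Measurable X) (hR : Measurable R)
    (hPU : PU = ℙ.map U)
    (hjoint : ℙ.map (fun ω => (U ω, X ω)) = (PU.prod lam).withDensity R)
    {D : Set 𝕏} (hD : MeasurableSet D) :
    ℙ[(X ⁻¹' D).indicator (fun _ => (1 : ℝ)) | MeasurableSpace.comap U inferInstance] =ᵐ[ℙ]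
        (fun ω => (∫⁻ x in D, R (U ω, x) ∂lam).toReal) ∧
      ∀ᵐ ω ∂ℙ, ∫⁻ x in D, R (U ω, x) ∂lam < ⊤ := by
  have hprob : IsProbabilityMeasure PU := hPU ▸ Measure.isProbabilityMeasure_map hU.aemeasurable
  have hg : Measurable fun u => ∫⁻ x in D, R (u, x) ∂lam := hR.lintegral_prod_right'
  have hset {A : Set 𝕌} (hA : MeasurableSet A) :
      ∫⁻ ω in U ⁻¹' A, ∫⁻ x in D, R (U ω, x) ∂lam ∂ℙ = ℙ (U ⁻¹' A ∩ X ⁻¹' D) := by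
    rw [measure_preimage_inter_eq_lintegral_density hU hX hR hjoint hA hD, hPU,
      setLIntegral_map hA hg hU]
  have hfin : ∫⁻ ω, ∫⁻ x in D, R (U ω, x) ∂lam ∂ℙ ≠ ⊤ := by
    have h := hset .univ
    rw [Set.preimage_univ, Measure.restrict_univ] at h
    exact h ▸ measure_ne_top _ _
  have hlt : ∀ᵐ ω ∂ℙ, ∫⁻ x in D, R (U ω, x) ∂lam < ⊤ := ae_lt_top (hg.comp hU) hfin
  refine ⟨?_, hlt⟩
  have hint : Integrable (fun ω => (∫⁻ x in D, R (U ω, x) ∂lam).toReal) ℙ :=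
    integrable_toReal_of_lintegral_ne_top (hg.comp hU).aemeasurable hfin
  refine (ae_eq_condExp_of_forall_setIntegral_eq hU.comap_le
    ((integrable_const 1).indicator (hX hD)) (fun _ _ _ => hint.integrableOn) ?_ ?_).symm
  · rintro _ ⟨A, hA, rfl⟩ _
    rw [integral_toReal (f := fun ω => ∫⁻ x in D, R (U ω, x) ∂lam)
        (hg.comp hU).aemeasurable.restrict (ae_restrict_of_ae hlt), hset hA,
      integral_indicator_const _ (hX hD), measureReal_restrict_apply (hX hD), smul_eq_mul,
      mul_one, Set.inter_comm]
    rfl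
  · exact (hg.ennreal_toReal.comp (comap_measurable U)).stronglyMeasurable.aestronglyMeasurable

end JointDensity

/-- If `V` and `W` are conditionally independent given `U`, the joint density of `(U, (V, W))` is
the product of the densities of `(U, V)` and `(U, W)`. -/
lemma map_prodMk_eq_withDensity_mul_of_condIndep {Ω 𝕌 𝕍 𝕎 : Type*} [MeasurableSpace Ω]
    [MeasurableSpace 𝕌] [MeasurableSpace 𝕍] [MeasurableSpace 𝕎]
    {ℙ : Measure Ω} [IsProbabilityMeasure ℙ] {U : Ω → 𝕌} {V : Ω → 𝕍} {W : Ω → 𝕎}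
    (hU : Measurable U) (hV : Measurable V) (hW : Measurable W)
    {lamV : Measure 𝕍} [SFinite lamV] {lamW : Measure 𝕎} [SFinite lamW]
    {PU : Measure 𝕌} (hPU : PU = ℙ.map U)
    {RV : 𝕌 × 𝕍 → ℝ≥0∞} (hRV : Measurable RV)
    (hjointV : ℙ.map (fun ω => (U ω, V ω)) = (PU.prod lamV).withDensity RV)
    {RW : 𝕌 × 𝕎 → ℝ≥0∞} (hRW : Measurable RW)
    (hjointW : ℙ.map (fun ω => (U ω, W ω)) = (PU.prod lamW).withDensity RW)
    (hCI : ∀ (B : Set 𝕍) (C : Set 𝕎), MeasurableSet B → MeasurableSet C →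
      ℙ[(V ⁻¹' B ∩ W ⁻¹' C).indicator (fun _ => (1 : ℝ)) |
          MeasurableSpace.comap U inferInstance] =ᵐ[ℙ]
        fun ω =>
          (ℙ[(V ⁻¹' B).indicator (fun _ => (1 : ℝ)) |
              MeasurableSpace.comap U inferInstance]) ω *
          (ℙ[(W ⁻¹' C).indicator (fun _ => (1 : ℝ)) |
              MeasurableSpace.comap U inferInstance]) ω) :
    ℙ.map (fun ω => (U ω, (V ω, W ω))) =
      (PU.prod (lamV.prod lamW)).withDensity fun p => RV (p.1, p.2.1) * RW (p.1, p.2.2) := by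
  have hprob : IsProbabilityMeasure PU := hPU ▸ Measure.isProbabilityMeasure_map hU.aemeasurable
  have hUVW : Measurable fun ω => (U ω, (V ω, W ω)) := hU.prodMk (hV.prodMk hW)
  have : IsProbabilityMeasure (ℙ.map fun ω => (U ω, (V ω, W ω))) :=
    Measure.isProbabilityMeasure_map hUVW.aemeasurable
  refine Measure.ext_prod₃ fun {A B C} hA hB hC => ?_
  have hgB : Measurable fun u => ∫⁻ v in B, RV (u, v) ∂lamV := hRV.lintegral_prod_right'
  have hgC : Measurable fun u => ∫⁻ w in C, RW (u, w) ∂lamW := hRW.lintegral_prod_right'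
  obtain ⟨hcB, hfB⟩ := condExp_indicator_ae_eq_lintegral_density hU hV hRV hPU hjointV hB
  obtain ⟨hcC, hfC⟩ := condExp_indicator_ae_eq_lintegral_density hU hW hRW hPU hjointW hC
  have hae : ℙ[(V ⁻¹' B ∩ W ⁻¹' C).indicator (fun _ => (1 : ℝ)) |
      MeasurableSpace.comap U inferInstance] =ᵐ[ℙ] fun ω =>
        (∫⁻ v in B, RV (U ω, v) ∂lamV).toReal * (∫⁻ w in C, RW (U ω, w) ∂lamW).toReal := by
    filter_upwards [hCI B C hB hC, hcB, hcC] with ω h hb hc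
    rw [h, hb, hc]
  have hBC : MeasurableSet (V ⁻¹' B ∩ W ⁻¹' C) := (hV hB).inter (hW hC)
  have hleft : ℙ.map (fun ω => (U ω, (V ω, W ω))) (A ×ˢ B ×ˢ C) =
      ∫⁻ u in A, (∫⁻ v in B, RV (u, v) ∂lamV) * ∫⁻ w in C, RW (u, w) ∂lamW ∂PU := by
    have hcond := setIntegral_condExp (μ := ℙ) hU.comap_le
      ((integrable_const (1 : ℝ)).indicator hBC) (⟨A, hA, rfl⟩ :
        MeasurableSet[MeasurableSpace.comap U inferInstance] (U ⁻¹' A))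
    rw [integral_congr_ae (ae_restrict_of_ae hae), integral_indicator_const _ hBC,
      measureReal_restrict_apply hBC, smul_eq_mul, mul_one] at hcond
    have hint := (integrable_condExp.congr hae).integrableOn (s := U ⁻¹' A)
    rw [Measure.map_apply hUVW (hA.prod (hB.prod hC)), hPU,
      setLIntegral_map (f := fun u => (∫⁻ v in B, RV (u, v) ∂lamV) * ∫⁻ w in C, RW (u, w) ∂lamW)
        hA (hgB.mul hgC) hU]
    calc ℙ ((fun ω => (U ω, (V ω, W ω))) ⁻¹' A ×ˢ B ×ˢ C)
        = ENNReal.ofReal (ℙ.real (V ⁻¹' B ∩ W ⁻¹' C ∩ U ⁻¹' A)) := by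
          rw [ofReal_measureReal, Set.inter_comm]
          rfl
      _ = _ := by
          rw [← hcond, ofReal_integral_eq_lintegral_ofReal hint
            (Filter.Eventually.of_forall fun _ => by positivity)]
          refine lintegral_congr_ae (ae_restrict_of_ae ?_)
          filter_upwards [hfB, hfC] with ω hb hc
          rw [ENNReal.ofReal_mul ENNReal.toReal_nonneg, ENNReal.ofReal_toReal hb.ne,
            ENNReal.ofReal_toReal hc.ne]
  have hR : Measurable fun p : 𝕌 × 𝕍 × 𝕎 => RV (p.1, p.2.1) * RW (p.1, p.2.2) := by fun_prop
  rw [hleft, withDensity_apply _ (hA.prod (hB.prod hC)), ← Measure.prod_restrict,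
    lintegral_prod _ hR.aemeasurable]
  refine lintegral_congr fun u => ?_
  rw [← Measure.prod_restrict]
  exact (lintegral_prod_mul (hRV.comp measurable_prodMk_left).aemeasurable
    (hRW.comp measurable_prodMk_left).aemeasurable).symm

/-- given a second observation `W` that is `U`-conditionally independent
of `V`, with `P_{UW} = R_W · (P_U ⊗ λ_W)`, the set
`Ω″ = {ω : 0 < ∫ R_W(u, W(ω)) P_{U|V}(ω)(du) < ∞}` is measurable with `ℙ(Ω″) = 1`, and
the recursively-defined `P_{U|VW}` is a regular `(V,W)`-conditional distribution for
`U`: `ω ↦ P_{U|VW}(ω)(A)` is `σ(V,W)`-measurable and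
`ℙ(U ∈ A, V ∈ B, W ∈ C) = ∫_{V ∈ B, W ∈ C} P_{U|VW}(ω)(A) ℙ(dω)`. -/
theorem stmt_3 {Ω 𝕌 𝕍 𝕎 : Type*} [MeasurableSpace Ω] [MeasurableSpace 𝕌]
    [MeasurableSpace 𝕍] [MeasurableSpace 𝕎]
    (ℙ : Measure Ω) [IsProbabilityMeasure ℙ]
    (U : Ω → 𝕌) (V : Ω → 𝕍) (W : Ω → 𝕎)
    (hU : Measurable U) (hV : Measurable V) (hW : Measurable W)
    (lamV : Measure 𝕍) [SigmaFinite lamV] (lamW : Measure 𝕎) [SigmaFinite lamW]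
    (PU : Measure 𝕌) [IsProbabilityMeasure PU] (hPU : PU = ℙ.map U)
    (RV : 𝕌 × 𝕍 → ℝ≥0) (hRV : Measurable RV)
    (hjointV : ℙ.map (fun ω => (U ω, V ω)) =
      (PU.prod lamV).withDensity fun p => (RV p : ℝ≥0∞))
    (RW : 𝕌 × 𝕎 → ℝ≥0) (hRW : Measurable RW)
    (hjointW : ℙ.map (fun ω => (U ω, W ω)) =
      (PU.prod lamW).withDensity fun p => (RW p : ℝ≥0∞))
    -- `V` and `W` are conditionally independent given `U`
    (hCI : ∀ (B : Set 𝕍) (C : Set 𝕎), MeasurableSet B → MeasurableSet C →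
      (ℙ[({ω | V ω ∈ B} ∩ {ω | W ω ∈ C}).indicator (fun _ => (1 : ℝ)) |
          MeasurableSpace.comap U inferInstance]) =ᵐ[ℙ]
        fun ω =>
          ((ℙ[Set.indicator ({ω | V ω ∈ B}) (fun _ => (1 : ℝ)) |
              MeasurableSpace.comap U inferInstance]) ω) *
          ((ℙ[Set.indicator ({ω | W ω ∈ C}) (fun _ => (1 : ℝ)) |
              MeasurableSpace.comap U inferInstance]) ω))
    -- the regular `V`-conditional distribution of `U`
    (Ω' : Set Ω)
    (hΩ' : Ω' = {ω | 0 < ∫⁻ u, (RV (u, V ω) : ℝ≥0∞) ∂PU ∧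
        ∫⁻ u, (RV (u, V ω) : ℝ≥0∞) ∂PU < ⊤})
    (PUV : Ω → Measure 𝕌)
    (hPUV_in : ∀ ω ∈ Ω', PUV ω = (∫⁻ u, (RV (u, V ω) : ℝ≥0∞) ∂PU)⁻¹ •
      PU.withDensity fun u => (RV (u, V ω) : ℝ≥0∞))
    (hPUV_out : ∀ ω ∉ Ω', PUV ω = PU)
    -- the recursive Bayes construction of the `(V,W)`-conditional distribution of `U`
    (Ω'' : Set Ω)
    (hΩ'' : Ω'' = {ω | 0 < ∫⁻ u, (RW (u, W ω) : ℝ≥0∞) ∂(PUV ω) ∧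
        ∫⁻ u, (RW (u, W ω) : ℝ≥0∞) ∂(PUV ω) < ⊤})
    (PUVW : Ω → Measure 𝕌)
    (hPUVW_in : ∀ ω ∈ Ω'', PUVW ω = (∫⁻ u, (RW (u, W ω) : ℝ≥0∞) ∂(PUV ω))⁻¹ •
      (PUV ω).withDensity fun u => (RW (u, W ω) : ℝ≥0∞))
    (hPUVW_out : ∀ ω ∉ Ω'', PUVW ω = PUV ω) :
    MeasurableSet Ω'' ∧ ℙ Ω'' = 1 ∧
    (∀ A : Set 𝕌, MeasurableSet A →
      Measurable[MeasurableSpace.comap (fun ω => (V ω, W ω)) inferInstance]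
        fun ω => PUVW ω A) ∧
    (∀ (A : Set 𝕌) (B : Set 𝕍) (C : Set 𝕎),
      MeasurableSet A → MeasurableSet B → MeasurableSet C →
      ℙ ({ω | U ω ∈ A} ∩ {ω | V ω ∈ B} ∩ {ω | W ω ∈ C}) =
        ∫⁻ ω in {ω | V ω ∈ B} ∩ {ω | W ω ∈ C}, PUVW ω A ∂ℙ) := by
  have hRV' : Measurable fun p => (RV p : ℝ≥0∞) := hRV.coe_nnreal_ennreal
  have hRW' : Measurable fun p => (RW p : ℝ≥0∞) := hRW.coe_nnreal_ennreal
  have hRVsec (v : 𝕍) : Measurable fun u => (RV (u, v) : ℝ≥0∞) := hRV'.comp measurable_prodMk_right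
  have hRWsec (w : 𝕎) : Measurable fun u => (RW (u, w) : ℝ≥0∞) := hRW'.comp measurable_prodMk_right
  have hVW : Measurable fun ω => (V ω, W ω) := hV.prodMk hW
  obtain ⟨R, hRdef⟩ : ∃ R : 𝕌 × 𝕍 × 𝕎 → ℝ≥0∞,
      R = fun p => (RV (p.1, p.2.1) : ℝ≥0∞) * RW (p.1, p.2.2) := ⟨_, rfl⟩
  have hR : Measurable R := by rw [hRdef]; fun_prop
  have hjoint : ℙ.map (fun ω => (U ω, (V ω, W ω))) = (PU.prod (lamV.prod lamW)).withDensity R :=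
    hRdef ▸ map_prodMk_eq_withDensity_mul_of_condIndep (RV := fun p => (RV p : ℝ≥0∞))
      (RW := fun p => (RW p : ℝ≥0∞)) hU hV hW hPU hRV' hjointV hRW' hjointW hCI
  set Z : 𝕍 → ℝ≥0∞ := fun v => ∫⁻ u, (RV (u, v) : ℝ≥0∞) ∂PU
  have hZ : Measurable Z := hRV'.lintegral_prod_left'
  set S : Set 𝕍 := {v | 0 < Z v ∧ Z v < ⊤}
  have hS : MeasurableSet S :=
    (measurableSet_lt measurable_const hZ).inter (measurableSet_lt hZ measurable_const)
  have hΩ'S : Ω' = V ⁻¹' S := hΩ'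
  have hPUV_lintegral (ω : Ω) (hω : ω ∈ Ω') {f : 𝕌 → ℝ≥0∞} (hf : Measurable f) :
      ∫⁻ u, f u ∂PUV ω = (Z (V ω))⁻¹ * ∫⁻ u, RV (u, V ω) * f u ∂PU := by
    rw [hPUV_in ω hω, lintegral_smul_measure,
      lintegral_withDensity_eq_lintegral_mul _ (hRVsec _) hf]
    rfl
  -- integrals against the `V`-posterior are measurable functions of the observations
  have hPUV_meas (f : 𝕌 × 𝕎 → ℝ≥0∞) (hf : Measurable f) :
      ∃ G : 𝕍 × 𝕎 → ℝ≥0∞, Measurable G ∧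
        ∀ ω, ∫⁻ u, f (u, W ω) ∂PUV ω = G (V ω, W ω) := by
    classical
    refine ⟨fun q => if q.1 ∈ S then (Z q.1)⁻¹ * ∫⁻ u, RV (u, q.1) * f (u, q.2) ∂PU
      else ∫⁻ u, f (u, q.2) ∂PU, ?_, fun ω => ?_⟩
    · refine Measurable.ite (measurable_fst hS) ?_ ?_
      · refine (hZ.comp measurable_fst).inv.mul ?_
        exact Measurable.lintegral_prod_left'
          (f := fun p : 𝕌 × 𝕍 × 𝕎 => (RV (p.1, p.2.1) : ℝ≥0∞) * f (p.1, p.2.2)) (by fun_prop)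
      · exact (hf.lintegral_prod_left' (μ := PU)).comp measurable_snd
    · by_cases hω : ω ∈ Ω'
      · have hωS : V ω ∈ S := by rwa [hΩ'S] at hω
        simp only [hωS, if_true]
        exact hPUV_lintegral ω hω (hf.comp measurable_prodMk_right)
      · have hωS : V ω ∉ S := by rwa [hΩ'S] at hω
        simp only [hωS, if_false, hPUV_out ω hω]
  obtain ⟨G, hG, hGeq⟩ := hPUV_meas _ hRW'
  set T : Set (𝕍 × 𝕎) := {q | 0 < G q ∧ G q < ⊤} with hTdef
  have hT : MeasurableSet T :=
    (measurableSet_lt measurable_const hG).inter (measurableSet_lt hG measurable_const)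
  have hΩ''T : Ω'' = (fun ω => (V ω, W ω)) ⁻¹' T := by
    rw [hΩ'']
    ext ω
    simp only [Set.mem_ofPred_eq, hGeq, Set.mem_preimage, hTdef]
  have haeΩ' : ∀ᵐ ω ∂ℙ, ω ∈ Ω' := by
    rw [hΩ']
    exact ae_lintegral_density_pos_lt_top hU hV hRV' hjointV
  have hkey (ω : Ω) (hω : ω ∈ Ω') :
      ∫⁻ u, (RW (u, W ω) : ℝ≥0∞) ∂PUV ω = (Z (V ω))⁻¹ * ∫⁻ u, R (u, (V ω, W ω)) ∂PU := by
    rw [hRdef]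
    exact hPUV_lintegral ω hω (hRWsec _)
  have hZinv (ω : Ω) (hω : ω ∈ Ω') : (Z (V ω))⁻¹ ≠ 0 ∧ (Z (V ω))⁻¹ ≠ ⊤ := by
    rw [hΩ'] at hω
    exact ⟨ENNReal.inv_ne_zero.2 hω.2.ne, ENNReal.inv_ne_top.2 hω.1.ne'⟩
  have haeΩ'' : ∀ᵐ ω ∂ℙ, ω ∈ Ω'' := by
    filter_upwards [haeΩ', ae_lintegral_density_pos_lt_top hU hVW hR hjoint] with ω hω hpos
    rw [hΩ'']
    simp only [Set.mem_ofPred_eq, hkey ω hω]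
    exact ⟨ENNReal.mul_pos (hZinv ω hω).1 hpos.1.ne',
      ENNReal.mul_lt_top (hZinv ω hω).2.lt_top hpos.2⟩
  have hΩ''meas : MeasurableSet Ω'' := hΩ''T ▸ hVW hT
  refine ⟨hΩ''meas, (prob_compl_eq_zero_iff hΩ''meas).1 haeΩ'', fun A hA => ?_,
    fun A B C hA hB hC => ?_⟩
  · classical
    obtain ⟨N, hN, hNeq⟩ := hPUV_meas (fun p => A.indicator (fun u => (RW (u, p.2) : ℝ≥0∞)) p.1)
      (hRW'.indicator (measurable_fst hA : MeasurableSet (Prod.fst ⁻¹' A)))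
    obtain ⟨M, hM, hMeq⟩ := hPUV_meas (fun p => A.indicator 1 p.1)
      ((measurable_one.indicator hA).comp measurable_fst)
    have hfun : (fun ω => PUVW ω A) =
        (fun q => if q ∈ T then (G q)⁻¹ * N q else M q) ∘ fun ω => (V ω, W ω) := by
      funext ω
      simp only [Function.comp_apply]
      by_cases hω : ω ∈ Ω''
      · have hωT : (V ω, W ω) ∈ T := by rwa [hΩ''T] at hω
        rw [if_pos hωT, hPUVW_in ω hω, Measure.smul_apply, withDensity_apply _ hA, smul_eq_mul,
          hGeq, ← hNeq, ← lintegral_indicator hA]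
      · have hωT : (V ω, W ω) ∉ T := by rwa [hΩ''T] at hω
        rw [if_neg hωT, hPUVW_out ω hω, ← hMeq, lintegral_indicator_one hA]
    rw [hfun]
    exact (Measurable.ite hT (hG.inv.mul hN) hM).comp (comap_measurable _)
  · have hbayes := measure_preimage_inter_eq_setLIntegral_bayes hU hVW hR hjoint hA (hB.prod hC)
    rw [Set.inter_assoc]
    refine hbayes.trans (lintegral_congr_ae (ae_restrict_of_ae ?_))
    filter_upwards [haeΩ', haeΩ''] with ω hω hω''
    obtain ⟨hz0, hzt⟩ := hZinv ω hω
    have hnum : ∫⁻ u in A, (RW (u, W ω) : ℝ≥0∞) ∂PUV ω =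
        (Z (V ω))⁻¹ * ∫⁻ u in A, R (u, (V ω, W ω)) ∂PU := by
      rw [← lintegral_indicator hA,
        hPUV_lintegral ω hω ((hRWsec _).indicator hA),
        ← lintegral_indicator hA]
      congr 2
      funext u
      by_cases hu : u ∈ A <;> simp [hu, hRdef]
    rw [hPUVW_in ω hω'', Measure.smul_apply, withDensity_apply _ hA, smul_eq_mul, hnum,
      hkey ω hω, ENNReal.mul_inv (Or.inl hz0) (Or.inl hzt), mul_mul_mul_comm,
      ENNReal.inv_mul_cancel hz0 hzt, one_mul]
end

section
/- The chart φ is injective: if p, q : X → (0, ∞) are measurable with ∫ p dμ = ∫ q dμ = 1 and there exists a constant c ∈ ℝ such that p + log p = q + log q + c μ-almost everywhere, then p = q μ-almost everywhere (and c = 0). -/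
open MeasureTheory

theorem strictMonoOn_add_log : StrictMonoOn (fun t : ℝ => t + Real.log t) (Set.Ioi 0) :=
  fun _ ha _ _ hab => add_lt_add hab (Real.log_lt_log ha hab)

theorem ae_eq_of_add_log_le {X : Type*} [MeasurableSpace X] {μ : Measure X} {p q : X → ℝ}
    (hp_pos : ∀ x, 0 < p x) (hq_pos : ∀ x, 0 < q x)
    (hp_int : Integrable p μ) (hq_int : Integrable q μ)
    (hpq : ∫ x, p x ∂μ = ∫ x, q x ∂μ)
    (h : ∀ᵐ x ∂μ, p x + Real.log (p x) ≤ q x + Real.log (q x)) :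
    p =ᵐ[μ] q := by
  refine (integral_eq_iff_of_ae_le hp_int hq_int ?_).1 hpq
  filter_upwards [h] with x hx
  exact (strictMonoOn_add_log.le_iff_le (hp_pos x) (hq_pos x)).1 hx

/-- injectivity of the chart `φ`: if `p, q` are strictly positive
probability densities with respect to `μ` and `p + log p = q + log q + c` holds
`μ`-a.e. for some constant `c`, then `p = q` `μ`-a.e. and `c = 0`. -/
theorem stmt_10 {X : Type*} [MeasurableSpace X] (μ : Measure X) [IsProbabilityMeasure μ]
    (p q : X → ℝ) (hp_meas : Measurable p) (hq_meas : Measurable q)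
    (hp_pos : ∀ x, 0 < p x) (hq_pos : ∀ x, 0 < q x)
    (hp_int : ∫ x, p x ∂μ = 1) (hq_int : ∫ x, q x ∂μ = 1)
    (c : ℝ)
    (h : ∀ᵐ x ∂μ, p x + Real.log (p x) = q x + Real.log (q x) + c) :
    (∀ᵐ x ∂μ, p x = q x) ∧ c = 0 := by
  have hp := integrable_of_integral_eq_one hp_int
  have hq := integrable_of_integral_eq_one hq_int
  have hpq : ∀ᵐ x ∂μ, p x = q x := by
    rcases le_total c 0 with hc | hc
    · refine ae_eq_of_add_log_le hp_pos hq_pos hp hq (hp_int.trans hq_int.symm) ?_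
      filter_upwards [h] with x hx
      linarith
    · refine Filter.EventuallyEq.symm
        (ae_eq_of_add_log_le hq_pos hp_pos hq hp (hq_int.trans hp_int.symm) ?_)
      filter_upwards [h] with x hx
      linarith
  refine ⟨hpq, ?_⟩
  obtain ⟨x, hx, hxc⟩ := (hpq.and h).exists
  rw [hx] at hxc
  linarith
end

section
/- Let ψ : ℝ → (0, ∞) be the inverse of the strictly increasing bijection (0, ∞) ∋ z ↦ z + log z ∈ ℝ, and let Z : L²(μ) → ℝ be the (well-defined, unique) function satisfying ∫ ψ(a + Z(a)) dμ = 1 for all a ∈ L²(μ). Then Z is Fréchet differentiable at every a ∈ L²(μ), with derivative DZ_a(u) = − (∫ ψ′(a + Z(a)) u dμ) / (∫ ψ′(a + Z(a)) dμ), where ψ′(t) = ψ(t)/(1 + ψ(t)). -/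
open MeasureTheory

/-- The remainder of the first-order expansion of the inverse of `z ↦ z + log z` is nonnegative
and at most quadratic. -/
lemma taylor_bounds_of_add_log {ψ : ℝ → ℝ} (hψ_pos : ∀ t, 0 < ψ t)
    (hψ_inv : ∀ t, ψ t + Real.log (ψ t) = t) (t h : ℝ) :
    ψ t / (1 + ψ t) * h ≤ ψ (t + h) - ψ t ∧
      ψ (t + h) - ψ t ≤ ψ t / (1 + ψ t) * h + h ^ 2 := by
  have hy := hψ_pos t
  have hy' := hψ_pos (t + h)
  have e₁ := hψ_inv t
  have e₂ := hψ_inv (t + h)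
  generalize ψ t = y at *
  generalize ψ (t + h) = y' at *
  obtain ⟨L, rfl⟩ : ∃ L, y' = y * Real.exp L :=
    ⟨Real.log (y' / y), by rw [Real.exp_log (by positivity)]; field_simp⟩
  rw [Real.log_mul hy.ne' (Real.exp_pos L).ne', Real.log_exp] at e₂
  have hh : h = y * (Real.exp L - 1) + L := by linarith
  have h1 : L + 1 ≤ Real.exp L := Real.add_one_le_exp L
  have key : y * Real.exp L - y - y / (1 + y) * h = y * (Real.exp L - 1 - L) / (1 + y) := by
    rw [hh]; field_simp; ring
  have lower : 0 ≤ y * (Real.exp L - 1 - L) / (1 + y) := by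
    have : 0 ≤ Real.exp L - 1 - L := by linarith
    positivity
  have upper : y * (Real.exp L - 1 - L) / (1 + y) ≤ h ^ 2 := by
    rw [div_le_iff₀ (by linarith)]
    rcases le_total 0 L with hL | hL
    · have h2 : 1 - L ≤ Real.exp (-L) := Real.one_sub_le_exp_neg L
      have h3 : Real.exp L * (1 - L) ≤ 1 := by
        calc Real.exp L * (1 - L) ≤ Real.exp L * Real.exp (-L) := by gcongr
          _ = 1 := by rw [← Real.exp_add]; simp
      have h4 : y * (Real.exp L - 1 - L) ≤ y * (Real.exp L - 1) * L := by nlinarith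
      have h5 : 0 ≤ y * (Real.exp L - 1) := mul_nonneg hy.le (by linarith)
      have h6 : y * (Real.exp L - 1) * L ≤ h ^ 2 := by rw [hh]; nlinarith
      nlinarith [sq_nonneg h]
    · have h2 : Real.exp L - 1 - L ≤ L ^ 2 := by
        rcases le_total (-1) L with hL' | hL'
        · have := Real.abs_exp_sub_one_sub_id_le (x := L) (abs_le.2 ⟨hL', by linarith⟩)
          exact (le_abs_self _).trans this
        · have : Real.exp L ≤ 1 := Real.exp_le_one_iff.2 hL
          nlinarith
      have h3 : Real.exp L - 1 ≤ 0 := by linarith [Real.exp_le_one_iff.2 hL]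
      have h4 : y * (Real.exp L - 1) ≤ 0 := mul_nonpos_of_nonneg_of_nonpos hy.le h3
      have h5 : L ^ 2 ≤ h ^ 2 := by rw [hh]; nlinarith
      calc y * (Real.exp L - 1 - L) ≤ y * h ^ 2 := by gcongr; linarith
        _ ≤ h ^ 2 * (1 + y) := by nlinarith [sq_nonneg h]
  constructor <;> linarith

lemma monotone_of_add_log {ψ : ℝ → ℝ} (hψ_pos : ∀ t, 0 < ψ t)
    (hψ_inv : ∀ t, ψ t + Real.log (ψ t) = t) : Monotone ψ := by
  intro s t hst
  have h := (taylor_bounds_of_add_log hψ_pos hψ_inv s (t - s)).1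
  have hs := hψ_pos s
  have : 0 ≤ ψ s / (1 + ψ s) * (t - s) := mul_nonneg (by positivity) (by linarith)
  rw [add_sub_cancel] at h
  linarith

lemma lipschitzWith_of_add_log {ψ : ℝ → ℝ} (hψ_pos : ∀ t, 0 < ψ t)
    (hψ_inv : ∀ t, ψ t + Real.log (ψ t) = t) : LipschitzWith 1 ψ := by
  refine LipschitzWith.of_le_add fun s t => ?_
  have h := (taylor_bounds_of_add_log hψ_pos hψ_inv s (t - s)).1
  have hs := hψ_pos s
  rw [add_sub_cancel] at h
  have h1 : ψ s / (1 + ψ s) ≤ 1 := by rw [div_le_one (by linarith)]; linarith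
  have h0 : 0 ≤ ψ s / (1 + ψ s) := by positivity
  have h2 : ψ s / (1 + ψ s) * (s - t) ≤ |s - t| :=
    calc ψ s / (1 + ψ s) * (s - t) ≤ ψ s / (1 + ψ s) * |s - t| := by
          gcongr; exact le_abs_self _
      _ ≤ 1 * |s - t| := by gcongr
      _ = |s - t| := one_mul _
  rw [Real.dist_eq]
  linarith

section Integral

variable {X : Type*} [MeasurableSpace X] {μ : Measure X} [IsProbabilityMeasure μ] {ψ : ℝ → ℝ}

lemma integrable_comp_of_add_log (hψ_pos : ∀ t, 0 < ψ t)
    (hψ_inv : ∀ t, ψ t + Real.log (ψ t) = t) {b : X → ℝ} (hb : MemLp b 2 μ) :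
    Integrable (fun x => ψ (b x)) μ := by
  have hl := lipschitzWith_of_add_log hψ_pos hψ_inv
  have hbi : Integrable b μ := hb.integrable one_le_two
  refine ((integrable_const (ψ 0)).add hbi.abs).mono'
    (hl.continuous.comp_aestronglyMeasurable hb.1) (.of_forall fun x => ?_)
  have := hl.dist_le_mul (b x) 0
  rw [Real.dist_eq, Real.dist_eq] at this
  simp only [NNReal.coe_one, one_mul, sub_zero] at this
  rw [Real.norm_eq_abs, abs_of_pos (hψ_pos _)]
  simp only [Pi.add_apply]
  linarith [le_abs_self (ψ (b x) - ψ 0)]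

lemma memLp_div_one_add_of_add_log (hψ_pos : ∀ t, 0 < ψ t)
    (hψ_inv : ∀ t, ψ t + Real.log (ψ t) = t) {b : X → ℝ} (hb : MemLp b 2 μ) :
    MemLp (fun x => ψ (b x) / (1 + ψ (b x))) 2 μ := by
  have hc := (lipschitzWith_of_add_log hψ_pos hψ_inv).continuous
  have hc' : Continuous fun t => ψ t / (1 + ψ t) :=
    hc.div (continuous_const.add hc) fun t => by linarith [hψ_pos t]
  refine MemLp.of_bound (hc'.comp_aestronglyMeasurable hb.1) 1 (.of_forall fun x => ?_)
  have := hψ_pos (b x)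
  rw [Real.norm_eq_abs, abs_of_pos (by positivity), div_le_one (by linarith)]
  linarith

lemma integral_taylor_bounds_of_add_log (hψ_pos : ∀ t, 0 < ψ t)
    (hψ_inv : ∀ t, ψ t + Real.log (ψ t) = t) {b w : X → ℝ} (hb : MemLp b 2 μ)
    (hw : MemLp w 2 μ) :
    ∫ x, ψ (b x) / (1 + ψ (b x)) * w x ∂μ ≤ ∫ x, ψ (b x + w x) ∂μ - ∫ x, ψ (b x) ∂μ ∧
      ∫ x, ψ (b x + w x) ∂μ - ∫ x, ψ (b x) ∂μ ≤
        ∫ x, ψ (b x) / (1 + ψ (b x)) * w x ∂μ + ∫ x, w x ^ 2 ∂μ := by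
  have i₁ := integrable_comp_of_add_log hψ_pos hψ_inv hb
  have i₂ : Integrable (fun x => ψ (b x + w x)) μ :=
    integrable_comp_of_add_log hψ_pos hψ_inv (hb.add hw)
  have i₃ : Integrable (fun x => ψ (b x) / (1 + ψ (b x)) * w x) μ :=
    (memLp_div_one_add_of_add_log hψ_pos hψ_inv hb).integrable_mul hw
  have i₄ : Integrable (fun x => w x ^ 2) μ := hw.integrable_sq
  rw [← integral_sub i₂ i₁, ← integral_add i₃ i₄]
  exact ⟨integral_mono i₃ (i₂.sub i₁) fun x => (taylor_bounds_of_add_log hψ_pos hψ_inv _ _).1,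
    integral_mono (i₂.sub i₁) (i₃.add i₄) fun x =>
      (taylor_bounds_of_add_log hψ_pos hψ_inv _ _).2⟩

end Integral

lemma Lp.integral_add_const_sq_le {X : Type*} [MeasurableSpace X] {μ : Measure X}
    [IsProbabilityMeasure μ] (u : Lp ℝ 2 μ) (k : ℝ) :
    ∫ x, (u x + k) ^ 2 ∂μ ≤ 2 * ‖u‖ ^ 2 + 2 * k ^ 2 := by
  have hu : MemLp u 2 μ := Lp.memLp u
  have hn : ‖u‖ ^ 2 = ∫ x, u x ^ 2 ∂μ := by
    rw [← real_inner_self_eq_norm_sq, L2.inner_def]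
    simp [sq]
  have hi : Integrable (fun x => 2 * u x ^ 2) μ := hu.integrable_sq.const_mul 2
  have hk : 2 * ‖u‖ ^ 2 + 2 * k ^ 2 = ∫ x, (2 * u x ^ 2 + 2 * k ^ 2) ∂μ := by
    rw [integral_add hi (integrable_const _), integral_const_mul, hn]
    simp
  rw [hk]
  exact integral_mono (hu.add (memLp_const k)).integrable_sq (hi.add (integrable_const _))
    fun x => by dsimp only; nlinarith [sq_nonneg (u x - k)]

/-- let `ψ : ℝ → (0,∞)` be the inverse of `z ↦ z + log z` and let
`Z : L²(μ) → ℝ` be the unique function with `∫ ψ(a + Z(a)) dμ = 1` for all `a`.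
Then `Z` is Fréchet differentiable at every `a`, with derivative
`DZ_a(u) = −(∫ ψ′(a + Z(a)) u dμ)/(∫ ψ′(a + Z(a)) dμ)` where `ψ′ = ψ/(1 + ψ)`. -/
theorem stmt_14 {X : Type*} [MeasurableSpace X] (μ : Measure X) [IsProbabilityMeasure μ]
    (ψ : ℝ → ℝ) (hψ_pos : ∀ t, 0 < ψ t) (hψ_inv : ∀ t, ψ t + Real.log (ψ t) = t)
    (Z : Lp ℝ 2 μ → ℝ) (hZ : ∀ a : Lp ℝ 2 μ, ∫ x, ψ (a x + Z a) ∂μ = 1) :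
    ∀ a : Lp ℝ 2 μ, ∃ D : Lp ℝ 2 μ →L[ℝ] ℝ, HasFDerivAt Z D a ∧
      ∀ u : Lp ℝ 2 μ,
        D u = -(∫ x, (ψ (a x + Z a) / (1 + ψ (a x + Z a))) * u x ∂μ) /
          ∫ x, ψ (a x + Z a) / (1 + ψ (a x + Z a)) ∂μ := by
  intro a
  have hb : MemLp (fun x => a x + Z a) 2 μ := (Lp.memLp a).add (memLp_const _)
  have hp := memLp_div_one_add_of_add_log hψ_pos hψ_inv hb
  have hpi : Integrable (fun x => ψ (a x + Z a) / (1 + ψ (a x + Z a))) μ :=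
    hp.integrable one_le_two
  set P := ∫ x, ψ (a x + Z a) / (1 + ψ (a x + Z a)) ∂μ with hP
  have hp_pos : ∀ x, 0 < ψ (a x + Z a) / (1 + ψ (a x + Z a)) := fun x => by
    have := hψ_pos (a x + Z a)
    positivity
  have hP_pos : 0 < P := by
    rw [hP, integral_pos_iff_support_of_nonneg (fun x => (hp_pos x).le) hpi,
      Function.support_eq_univ fun x => (hp_pos x).ne']
    simp
  set A : Lp ℝ 2 μ →L[ℝ] ℝ := innerSL ℝ (hp.toLp _) with hA
  have hA_apply : ∀ u : Lp ℝ 2 μ,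
      A u = ∫ x, ψ (a x + Z a) / (1 + ψ (a x + Z a)) * u x ∂μ := fun u => by
    rw [hA, innerSL_apply_apply, L2.inner_def]
    refine integral_congr_ae ?_
    filter_upwards [hp.coeFn_toLp] with x hx
    rw [hx]
    simp [mul_comm]
  -- First-order expansion of `∫ ψ (a + Z a + u + k)` in the direction `u + k`.
  have expand : ∀ (u : Lp ℝ 2 μ) (k : ℝ),
      A u + k * P ≤ ∫ x, ψ (a x + Z a + (u x + k)) ∂μ - 1 ∧
      ∫ x, ψ (a x + Z a + (u x + k)) ∂μ - 1 ≤
        A u + k * P + (2 * ‖u‖ ^ 2 + 2 * k ^ 2) := fun u k => by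
    have hu : MemLp (fun x => u x + k) 2 μ := (Lp.memLp u).add (memLp_const _)
    have hlin : ∫ x, ψ (a x + Z a) / (1 + ψ (a x + Z a)) * (u x + k) ∂μ = A u + k * P := by
      have hpu : Integrable (fun x => ψ (a x + Z a) / (1 + ψ (a x + Z a)) * u x) μ :=
        hp.integrable_mul (Lp.memLp u)
      rw [hA_apply, mul_comm k, hP, ← integral_mul_const, ← integral_add hpu (hpi.mul_const k)]
      simp only [mul_add]
    have h := integral_taylor_bounds_of_add_log hψ_pos hψ_inv hb hu
    rw [hZ a, hlin] at h
    exact ⟨h.1, h.2.trans (by gcongr; exact Lp.integral_add_const_sq_le u k)⟩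
  have hshift : ∀ u : Lp ℝ 2 μ,
      ∫ x, ψ (a x + Z a + (u x + (Z (a + u) - Z a))) ∂μ = 1 := fun u => by
    rw [← hZ (a + u)]
    refine integral_congr_ae ?_
    filter_upwards [Lp.coeFn_add a u] with x hx
    rw [hx, Pi.add_apply]
    ring_nf
  set Q := ‖A‖
  have hQ : 0 ≤ Q := norm_nonneg A
  have hAu : ∀ u, |A u| ≤ Q * ‖u‖ := fun u => A.le_opNorm u
  have decrease : ∀ (u : Lp ℝ 2 μ) (m : ℝ), m ≤ -(Z (a + u) - Z a) →
      m * P ≤ Q * ‖u‖ + 2 * ‖u‖ ^ 2 + 2 * m ^ 2 := fun u m hm => by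
    have hmono : (1 : ℝ) ≤ ∫ x, ψ (a x + Z a + (u x + -m)) ∂μ := by
      rw [← hshift u]
      have hψ_int : ∀ k : ℝ, Integrable (fun x => ψ (a x + Z a + (u x + k))) μ := fun k =>
        integrable_comp_of_add_log hψ_pos hψ_inv
          (hb.add ((Lp.memLp u).add (memLp_const k)))
      exact integral_mono (hψ_int _) (hψ_int _) fun x =>
        monotone_of_add_log hψ_pos hψ_inv (by linarith)
    have h := (expand u (-m)).2
    nlinarith [le_abs_self (A u), hAu u]
  obtain ⟨C, hC, δ, hδ, hlocal⟩ : ∃ C : ℝ, 0 ≤ C ∧ ∃ δ > 0, ∀ u : Lp ℝ 2 μ, ‖u‖ < δ →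
      |Z (a + u) - Z a| ≤ C * ‖u‖ := by
    refine ⟨2 * (Q + 2) / P, by positivity, min 1 (P ^ 2 / (8 * (Q + 2))), by positivity,
      fun u hu => ?_⟩
    obtain ⟨hu1, hu2⟩ := lt_min_iff.1 hu
    have hu0 := norm_nonneg u
    rw [lt_div_iff₀ (by positivity)] at hu2
    rw [div_mul_eq_mul_div, le_div_iff₀ hP_pos]
    have hup : (Z (a + u) - Z a) * P ≤ Q * ‖u‖ := by
      have h := (expand u (Z (a + u) - Z a)).1
      rw [hshift u] at h
      linarith [neg_abs_le (A u), hAu u]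
    have hsq : ‖u‖ ^ 2 ≤ ‖u‖ := by nlinarith
    have hlt : -(Z (a + u) - Z a) < P / 4 := by
      by_contra! hge
      have := decrease u _ hge
      nlinarith
    have hdown := decrease u _ le_rfl
    rcases abs_cases (Z (a + u) - Z a) with ⟨h, -⟩ | ⟨h, hneg⟩
    · rw [h]; nlinarith
    · rw [h]; nlinarith
  refine ⟨-P⁻¹ • A, ?_, fun u => ?_⟩
  · rw [hasFDerivAt_iff_isLittleO_nhds_zero]
    have hO : (fun u => Z (a + u) - Z a - (-P⁻¹ • A) u) =O[nhds 0]
        fun u : Lp ℝ 2 μ => ‖u‖ ^ 2 := by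
      refine Asymptotics.IsBigO.of_bound ((2 + 2 * C ^ 2) / P) ?_
      filter_upwards [Metric.ball_mem_nhds 0 hδ] with u hu
      have hk := hlocal u (by simpa using hu)
      obtain ⟨h₁, h₂⟩ := expand u (Z (a + u) - Z a)
      rw [hshift u] at h₁ h₂
      have hk2 : (Z (a + u) - Z a) ^ 2 ≤ C ^ 2 * ‖u‖ ^ 2 := by
        rw [← sq_abs, ← mul_pow]
        gcongr
      have heq : Z (a + u) - Z a - (-P⁻¹ • A) u = (A u + (Z (a + u) - Z a) * P) / P := by
        simp only [smul_apply, smul_eq_mul]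
        field_simp
        ring
      rw [heq, norm_div, Real.norm_of_nonneg hP_pos.le, div_mul_eq_mul_div, Real.norm_eq_abs,
        norm_pow, norm_norm]
      gcongr
      rw [abs_le]
      constructor <;> nlinarith [sq_nonneg ‖u‖, sq_nonneg (C * ‖u‖)]
    refine hO.trans_isLittleO ?_
    simpa using (Asymptotics.isLittleO_norm_pow_id (E' := Lp ℝ 2 μ) one_lt_two)
  · rw [smul_apply, hA_apply, smul_eq_mul]
    ring
end

section
/- Let A and β be symmetric real m×m matrices, B a real m×m matrix, α ∈ ℝ^m, c ∈ ℝ, and define q : ℝ^m → ℝ by q(x) = exp(−(1/2)⟨x, βx⟩ + ⟨α, x⟩ − c). Then q is smooth, and for every x ∈ ℝ^m, (1/2) Σ_{i,j} A_{ij} ∂²q/∂x_i∂x_j (x) − Σ_i ∂/∂x_i [ (Bx)_i q(x) ] = q(x) · [ (1/2)⟨x, β(Aβ + 2B)x⟩ − ⟨α, (Aβ + B)x⟩ + (1/2)(⟨α, Aα⟩ − tr(Aβ + 2B)) ]. -/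
open Matrix

namespace GaussianFokkerPlanck

variable {m : ℕ}

lemma mulVec_dotProduct_of_isSymm {M : Matrix (Fin m) (Fin m) ℝ} (hM : M.IsSymm)
    (x y : Fin m → ℝ) : M *ᵥ x ⬝ᵥ y = x ⬝ᵥ M *ᵥ y := by
  rw [dotProduct_mulVec, ← mulVec_transpose, hM.eq]

/-- The continuous linear functional `v ↦ a ⬝ᵥ v`. -/
noncomputable def dotProductCLM (a : Fin m → ℝ) : (Fin m → ℝ) →L[ℝ] ℝ :=
  (dotProductBilin ℝ ℝ a).toContinuousLinearMap

@[simp]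
lemma dotProductCLM_apply (a v : Fin m → ℝ) : dotProductCLM a v = a ⬝ᵥ v := rfl

lemma hasFDerivAt_dotProduct (a x : Fin m → ℝ) :
    HasFDerivAt (fun y => a ⬝ᵥ y) (dotProductCLM a) x :=
  (dotProductCLM a).hasFDerivAt

lemma hasFDerivAt_mulVec_apply (M : Matrix (Fin m) (Fin m) ℝ) (i : Fin m) (x : Fin m → ℝ) :
    HasFDerivAt (fun y => (M *ᵥ y) i) (dotProductCLM (M i)) x :=
  hasFDerivAt_dotProduct (M i) x

lemma hasFDerivAt_quadratic {β : Matrix (Fin m) (Fin m) ℝ} (hβ : β.IsSymm) (x : Fin m → ℝ) :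
    HasFDerivAt (fun y => y ⬝ᵥ β *ᵥ y) (dotProductCLM ((2 : ℝ) • β *ᵥ x)) x := by
  have h := HasFDerivAt.fun_sum (u := Finset.univ) fun i _ =>
    (hasFDerivAt_apply (𝕜 := ℝ) i x).mul (hasFDerivAt_mulVec_apply β i x)
  refine h.congr_fderiv ?_
  ext1 v
  have h1 : (∑ i, x i * (β i ⬝ᵥ v)) = β *ᵥ x ⬝ᵥ v :=
    (mulVec_dotProduct_of_isSymm hβ x v).symm
  have h2 : (∑ i, (β *ᵥ x) i * v i) = β *ᵥ x ⬝ᵥ v := rfl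
  simp [Finset.sum_add_distrib, smul_dotProduct, h1, h2]
  ring

/-- The function `x ↦ exp(−½⟨x, βx⟩ + ⟨α, x⟩ − c)`. -/
noncomputable def gaussian (β : Matrix (Fin m) (Fin m) ℝ) (α : Fin m → ℝ) (c : ℝ)
    (x : Fin m → ℝ) : ℝ :=
  Real.exp (-(1 / 2) * (x ⬝ᵥ β *ᵥ x) + α ⬝ᵥ x - c)

lemma contDiff_gaussian (β : Matrix (Fin m) (Fin m) ℝ) (α : Fin m → ℝ) (c : ℝ)
    {n : WithTop ℕ∞} : ContDiff ℝ n (gaussian β α c) := by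
  unfold gaussian mulVec dotProduct
  fun_prop

lemma hasFDerivAt_gaussian {β : Matrix (Fin m) (Fin m) ℝ} (hβ : β.IsSymm) (α : Fin m → ℝ)
    (c : ℝ) (x : Fin m → ℝ) :
    HasFDerivAt (gaussian β α c) (gaussian β α c x • dotProductCLM (α - β *ᵥ x)) x := by
  have h := ((((hasFDerivAt_quadratic hβ x).const_mul (-(1 / 2))).add
    (hasFDerivAt_dotProduct α x)).sub_const c).exp
  refine h.congr_fderiv ?_
  ext1 v
  simp [gaussian, smul_dotProduct, sub_dotProduct]
  ring

lemma fderiv_gaussian_single {β : Matrix (Fin m) (Fin m) ℝ} (hβ : β.IsSymm) (α : Fin m → ℝ)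
    (c : ℝ) (x : Fin m → ℝ) (j : Fin m) :
    fderiv ℝ (gaussian β α c) x (Pi.single j 1) = gaussian β α c x * (α j - (β *ᵥ x) j) := by
  simp [(hasFDerivAt_gaussian hβ α c x).fderiv]

lemma fderiv_fderiv_gaussian_single {β : Matrix (Fin m) (Fin m) ℝ} (hβ : β.IsSymm)
    (α : Fin m → ℝ) (c : ℝ) (x : Fin m → ℝ) (i j : Fin m) :
    fderiv ℝ (fun y => fderiv ℝ (gaussian β α c) y (Pi.single j 1)) x (Pi.single i 1) =
      gaussian β α c x * ((α i - (β *ᵥ x) i) * (α j - (β *ᵥ x) j) - β j i) := by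
  simp_rw [fderiv_gaussian_single hβ]
  rw [((hasFDerivAt_gaussian hβ α c x).fun_mul
    ((hasFDerivAt_mulVec_apply β j x).const_sub (α j))).fderiv]
  simp
  ring

lemma fderiv_mulVec_mul_gaussian_single {β : Matrix (Fin m) (Fin m) ℝ} (hβ : β.IsSymm)
    (B : Matrix (Fin m) (Fin m) ℝ) (α : Fin m → ℝ) (c : ℝ) (x : Fin m → ℝ) (i : Fin m) :
    fderiv ℝ (fun y => (B *ᵥ y) i * gaussian β α c y) x (Pi.single i 1) =
      gaussian β α c x * (B i i + (α i - (β *ᵥ x) i) * (B *ᵥ x) i) := by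
  rw [((hasFDerivAt_mulVec_apply B i x).fun_mul (hasFDerivAt_gaussian hβ α c x)).fderiv]
  simp
  ring

end GaussianFokkerPlanck

open GaussianFokkerPlanck in
/-- for symmetric `A, β`, any `B`, `α`, `c`, and
`q(x) = exp(−½⟨x, βx⟩ + ⟨α, x⟩ − c)`, the function `q` is smooth and the
Fokker–Planck operator with diffusion matrix `A` and drift `x ↦ Bx` satisfies
`½ Σ_{ij} A_{ij} ∂²q/∂xᵢ∂xⱼ − Σ_i ∂ᵢ[(Bx)ᵢ q]
  = q·[½⟨x, β(Aβ+2B)x⟩ − ⟨α, (Aβ+B)x⟩ + ½(⟨α, Aα⟩ − tr(Aβ+2B))]`. -/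
theorem stmt_19 {m : ℕ} (A B β : Matrix (Fin m) (Fin m) ℝ)
    (hA : A.IsSymm) (hβ : β.IsSymm) (α : Fin m → ℝ) (c : ℝ)
    (q : (Fin m → ℝ) → ℝ)
    (hq : q = fun x => Real.exp (-(1 / 2) * (x ⬝ᵥ β.mulVec x) + α ⬝ᵥ x - c)) :
    ContDiff ℝ (⊤ : ℕ∞) q ∧
    ∀ x : Fin m → ℝ,
      (1 / 2) * ∑ i, ∑ j, A i j *
          fderiv ℝ (fun y => fderiv ℝ q y (Pi.single j 1)) x (Pi.single i 1)
        - ∑ i, fderiv ℝ (fun y => B.mulVec y i * q y) x (Pi.single i 1)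
      = q x * ((1 / 2) * (x ⬝ᵥ (β * (A * β + 2 • B)).mulVec x)
          - α ⬝ᵥ (A * β + B).mulVec x
          + (1 / 2) * (α ⬝ᵥ A.mulVec α - (A * β + 2 • B).trace)) := by
  obtain rfl : q = gaussian β α c := hq
  refine ⟨contDiff_gaussian β α c, fun x => ?_⟩
  simp_rw [fderiv_fderiv_gaussian_single hβ, fderiv_mulVec_mul_gaussian_single hβ]
  set g := α - β *ᵥ x with hg
  have hdiff : ∑ i, ∑ j, A i j *
      (gaussian β α c x * ((α i - (β *ᵥ x) i) * (α j - (β *ᵥ x) j) - β j i)) =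
      gaussian β α c x * (g ⬝ᵥ A *ᵥ g - (A * β).trace) := by
    simp only [hg, dotProduct, mulVec, trace, diag_apply, mul_apply, Pi.sub_apply,
      Finset.mul_sum, ← Finset.sum_sub_distrib]
    refine Finset.sum_congr rfl fun i _ => Finset.sum_congr rfl fun j _ => ?_
    ring
  have hdrift : ∑ i, gaussian β α c x * (B i i + (α i - (β *ᵥ x) i) * (B *ᵥ x) i) =
      gaussian β α c x * (B.trace + g ⬝ᵥ B *ᵥ x) := by
    rw [← Finset.mul_sum, Finset.sum_add_distrib]
    rfl
  have hcross : x ⬝ᵥ β *ᵥ A *ᵥ α = α ⬝ᵥ A *ᵥ β *ᵥ x := by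
    rw [← mulVec_dotProduct_of_isSymm hβ, ← mulVec_dotProduct_of_isSymm hA, dotProduct_comm]
  rw [hdiff, hdrift, hg]
  simp only [two_smul, mulVec_sub, add_mulVec, mul_add, ← mulVec_mulVec,
    sub_dotProduct, dotProduct_sub, dotProduct_add, trace_add, mulVec_dotProduct_of_isSymm hβ, hcross]
  ring
end
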